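/- (Convolution preserves even nonincreasing profiles, dimension 1.) Let K, J ∈ L¹(ℝ) be nonnegative even functions that are nonincreasing on (0, +∞), and assume additionally K ∈ C¹(ℝ) with K' ∈ L¹(ℝ). Then H := K * J is even and H'(x) = ∫₀^∞ K'(y)(J(|x−y|) − J(x+y)) dy ≤ 0 for x > 0; in particular H is nonincreasing on (0, +∞). -/

import Mathlib

open MeasureTheory Real Set Filter

/-- Convolving a continuous function with an integrable function of bounded support. -/
lemma integrable_sub_mul_of_bounded_support {k j : ℝ → ℝ} {R : ℝ} (hk : Continuous k)
    (hj : Integrable j) (hR : ∀ y, R < |y| → j y = 0) (x : ℝ) :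
    Integrable fun y => k (x - y) * j y := by
  obtain ⟨C, hC⟩ := (isCompact_Icc (a := x - R) (b := x + R)).exists_bound_of_continuousOn
    hk.continuousOn
  refine (hj.norm.const_mul C).mono'
    ((hk.comp (continuous_const.sub continuous_id)).aestronglyMeasurable.mul hj.1)
    (Eventually.of_forall fun y => ?_)
  by_cases hy : R < |y|
  · simp [hR y hy]
  · rw [norm_mul]
    have := abs_le.1 (not_lt.1 hy)
    exact mul_le_mul_of_nonneg_right (hC _ ⟨by linarith, by linarith⟩) (norm_nonneg _)

lemma continuous_integral_sub_mul_of_bounded_support {k j : ℝ → ℝ} {R : ℝ} (hk : Continuous k)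
    (hj : Integrable j) (hR : ∀ y, R < |y| → j y = 0) :
    Continuous fun x => ∫ y, k (x - y) * j y := by
  refine continuous_iff_continuousAt.2 fun x => ?_
  obtain ⟨C, hC⟩ := (isCompact_Icc (a := x - 1 - R) (b := x + 1 + R)).exists_bound_of_continuousOn
    hk.continuousOn
  refine continuousAt_of_dominated (bound := fun y => C * ‖j y‖)
    (Eventually.of_forall fun z => (integrable_sub_mul_of_bounded_support hk hj hR z).1) ?_
    (hj.norm.const_mul C) (Eventually.of_forall fun y => by fun_prop)
  filter_upwards [Icc_mem_nhds (sub_one_lt x) (lt_add_one x)] with z hz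
  refine Eventually.of_forall fun y => ?_
  by_cases hy : R < |y|
  · simp [hR y hy]
  · rw [norm_mul]
    have := abs_le.1 (not_lt.1 hy)
    exact mul_le_mul_of_nonneg_right (hC _ ⟨by linarith [hz.1], by linarith [hz.2]⟩)
      (norm_nonneg _)

/-- Convolving an integrable function with a bounded radially nonincreasing function. -/
lemma continuous_integral_sub_mul_antitone_abs {k g : ℝ → ℝ} {C : ℝ} (hk : Integrable k)
    (hg : Antitone g) (hC : ∀ y, ‖g y‖ ≤ C) :
    Continuous fun x => ∫ y, k (x - y) * g |y| := by
  have hswap : ∀ x, ∫ y, k (x - y) * g |y| = ∫ y, k y * g |x - y| := fun x => by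
    simpa using integral_sub_left_eq_self (fun y => k y * g |x - y|) volume x
  simp only [hswap]
  refine continuous_iff_continuousAt.2 fun x => ?_
  refine continuousAt_of_dominated (bound := fun y => ‖k y‖ * C)
    (Eventually.of_forall fun z => hk.1.mul
      (hg.measurable.comp (by fun_prop : Measurable fun y => |z - y|)).aestronglyMeasurable)
    (Eventually.of_forall fun z => Eventually.of_forall fun y => ?_)
    (hk.norm.mul_const C) ?_
  · rw [norm_mul]
    exact mul_le_mul_of_nonneg_left (hC _) (norm_nonneg _)
  · have hD := hg.countable_not_continuousAt
    filter_upwards [((hD.image (fun d => x - d)).union (hD.image (fun d => x + d))).ae_notMem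
      volume] with y hy
    have hcont : ContinuousAt g |x - y| := by
      by_contra hne
      refine hy ?_
      rcases abs_choice (x - y) with h | h
      · exact Or.inl ⟨|x - y|, hne, by simp only [h]; ring⟩
      · exact Or.inr ⟨|x - y|, hne, by simp only [h]; ring⟩
    exact continuousAt_const.mul
      (ContinuousAt.comp (f := fun z => |z - y|) hcont (by fun_prop))

/-- The derivative of a convolution, when the convolution with the derivative is continuous. -/
lemma hasDerivAt_integral_sub_mul {K J : ℝ → ℝ} (hJ : Integrable J) (hK : ContDiff ℝ 1 K)
    (hK' : Integrable (deriv K)) (hKJ : ∀ x, Integrable fun y => K (x - y) * J y)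
    (hcont : Continuous fun x => ∫ y, deriv K (x - y) * J y) (x : ℝ) :
    HasDerivAt (fun x => ∫ y, K (x - y) * J y) (∫ y, deriv K (x - y) * J y) x := by
  have hK'c : Continuous (deriv K) := hK.continuous_deriv le_rfl
  have hint : Integrable (fun p : ℝ × ℝ => deriv K (p.1 - p.2) * J p.2) (volume.prod volume) := by
    simpa [mul_comm] using hJ.convolution_integrand (ContinuousLinearMap.mul ℝ ℝ) hK'
  have key : ∀ z, ∫ y, K (z - y) * J y =
      (∫ y, K (0 - y) * J y) + ∫ s in (0 : ℝ)..z, ∫ y, deriv K (s - y) * J y := fun z => by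
    rw [intervalIntegral_integral_swap, ← sub_eq_iff_eq_add', ← integral_sub (hKJ z) (hKJ 0)]
    · refine integral_congr_ae (Eventually.of_forall fun y => ?_)
      dsimp only
      rw [intervalIntegral.integral_mul_const, intervalIntegral.integral_comp_sub_right,
        intervalIntegral.integral_eq_sub_of_hasDerivAt
          (fun t _ => (hK.differentiable one_ne_zero t).hasDerivAt)
          (hK'c.intervalIntegrable _ _)]
      ring
    · exact hint.mono_measure (Measure.prod_mono Measure.restrict_le_self le_rfl)
  rw [funext key]
  exact (hcont.integral_hasStrictDerivAt 0 x).hasDerivAt.const_add _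

/-- If `K, J ∈ L¹(ℝ)` are nonnegative even functions, nonincreasing on
`(0,∞)`, and `K` is `C¹` with `K' ∈ L¹(ℝ)`, then `H := K * J` is even and for `x > 0`,
`H'(x) = ∫₀^∞ K'(y)(J(|x−y|) − J(x+y)) dy ≤ 0`; in particular `H` is nonincreasing on
`(0, ∞)`. -/
theorem stmt2 (K J : ℝ → ℝ)
    (hKint : Integrable K) (hJint : Integrable J)
    (hKpos : ∀ x, 0 ≤ K x) (hJpos : ∀ x, 0 ≤ J x)
    (hKeven : ∀ x, K (-x) = K x) (hJeven : ∀ x, J (-x) = J x)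
    (hKmono : AntitoneOn K (Set.Ioi 0)) (hJmono : AntitoneOn J (Set.Ioi 0))
    (hKC1 : ContDiff ℝ 1 K) (hK'int : Integrable (deriv K))
    (H : ℝ → ℝ) (hH : ∀ x, H x = ∫ y, K (x - y) * J y) :
    (∀ x, H (-x) = H x) ∧
    (∀ x > 0, deriv H x = ∫ y in Set.Ioi (0:ℝ), deriv K y * (J |x - y| - J (x + y))) ∧
    (∀ x > 0, deriv H x ≤ 0) ∧
    AntitoneOn H (Set.Ioi 0) := by
  have hJabs : ∀ t, J |t| = J t := fun t => by
    rcases abs_choice t with h | h <;> simp [h, hJeven]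
  have hKc : Continuous K := hKC1.continuous
  have hK'c : Continuous (deriv K) := hKC1.continuous_deriv le_rfl
  have hK'odd : ∀ y, deriv K (-y) = -deriv K y := fun y => by
    have h := deriv_comp_neg K y
    simp only [hKeven] at h
    linarith
  have hK'nonpos : ∀ y > 0, deriv K y ≤ 0 := fun y hy => by
    rw [← derivWithin_of_isOpen isOpen_Ioi (show y ∈ Ioi (0 : ℝ) from hy)]
    exact hKmono.derivWithin_nonpos
  -- Split `J` into a bounded part and a part supported in `[-1, 1]`.
  let g : ℝ → ℝ := fun t => J (max t 1)
  have hg : Antitone g := fun a b hab => hJmono (show 0 < max a 1 by simp)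
    (show 0 < max b 1 by simp) (max_le_max_right 1 hab)
  have hgC : ∀ t, ‖g t‖ ≤ J 1 := fun t => by
    rw [norm_of_nonneg (hJpos _)]
    exact hJmono (show (0 : ℝ) < 1 by simp) (show 0 < max t 1 by simp) (le_max_right _ _)
  have hgm : Measurable fun y => g |y| := hg.measurable.comp (by fun_prop)
  have hsupp : ∀ y, 1 < |y| → J y - g |y| = 0 := fun y hy => by
    simp only [g, max_eq_left hy.le, hJabs, sub_self]
  have hnear : Integrable fun y => J y - g |y| := by
    have h : IntegrableOn (fun y => J y - g |y|) (Icc (-1) 1) :=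
      hJint.integrableOn.sub (Measure.integrableOn_of_bounded (M := J 1) (by simp)
        hgm.aestronglyMeasurable (Eventually.of_forall fun y => hgC _))
    refine h.integrable_of_forall_notMem_eq_zero fun y hy => hsupp y ?_
    by_contra hle
    exact hy (abs_le.1 (not_lt.1 hle))
  have hsplit : ∀ (k : ℝ → ℝ) x, (fun y => k (x - y) * J y) =
      fun y => k (x - y) * (J y - g |y|) + k (x - y) * g |y| := fun k x => by
    funext y; ring
  have hfar : ∀ {k : ℝ → ℝ}, Integrable k → ∀ x, Integrable fun y => k (x - y) * g |y| :=
    fun hk x => (hk.comp_sub_left x).mul_bdd hgm.aestronglyMeasurable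
      (Eventually.of_forall fun y => hgC _)
  have hconv : ∀ {k : ℝ → ℝ}, Continuous k → Integrable k → ∀ x,
      Integrable fun y => k (x - y) * J y := fun hkc hk x => by
    rw [hsplit]
    exact (integrable_sub_mul_of_bounded_support hkc hnear hsupp x).add (hfar hk x)
  have hcont : Continuous fun x => ∫ y, deriv K (x - y) * J y := by
    have h : ∀ x, ∫ y, deriv K (x - y) * J y =
        (∫ y, deriv K (x - y) * (J y - g |y|)) + ∫ y, deriv K (x - y) * g |y| := fun x => by
      rw [hsplit, integral_add (integrable_sub_mul_of_bounded_support hK'c hnear hsupp x)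
        (hfar hK'int x)]
    rw [funext h]
    exact (continuous_integral_sub_mul_of_bounded_support hK'c hnear hsupp).add
      (continuous_integral_sub_mul_antitone_abs hK'int hg hgC)
  have hderiv : ∀ x, HasDerivAt H (∫ y, deriv K (x - y) * J y) x := fun x => by
    rw [funext hH]
    exact hasDerivAt_integral_sub_mul hJint hKC1 hK'int (hconv hKc hKint) hcont x
  have hformula : ∀ x, deriv H x =
      ∫ y in Ioi (0 : ℝ), deriv K y * (J |x - y| - J (x + y)) := fun x => by
    have hi : Integrable fun y => deriv K y * J (x - y) := by
      simpa using (hconv hK'c hK'int x).comp_sub_left x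
    have hi' : Integrable fun y => deriv K (-y) * J (x + y) := by
      simpa using hi.comp_neg
    have hneg := integral_comp_neg_Ioi 0 (fun y => deriv K y * J (x - y))
    simp only [sub_neg_eq_add, neg_zero] at hneg
    rw [(hderiv x).deriv]
    calc ∫ y, deriv K (x - y) * J y = ∫ y, deriv K y * J (x - y) := by
          simpa using integral_sub_left_eq_self (fun y => deriv K y * J (x - y)) volume x
      _ = (∫ y in Ioi (0 : ℝ), deriv K (-y) * J (x + y)) +
          ∫ y in Ioi (0 : ℝ), deriv K y * J (x - y) := by
          rw [hneg, intervalIntegral.integral_Iic_add_Ioi hi.integrableOn hi.integrableOn]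
      _ = ∫ y in Ioi (0 : ℝ), deriv K y * (J |x - y| - J (x + y)) := by
          rw [← integral_add hi'.integrableOn hi.integrableOn]
          refine integral_congr_ae (Eventually.of_forall fun y => ?_)
          simp only [hK'odd, hJabs]
          ring
  have hnonpos : ∀ x > 0, deriv H x ≤ 0 := fun x hx => by
    rw [hformula]
    refine setIntegral_nonpos_of_ae_restrict ((ae_restrict_iff' measurableSet_Ioi).2 ?_)
    filter_upwards [(countable_singleton x).ae_notMem volume] with y hyx hy
    have hy : 0 < y := hy
    have hpos : 0 < |x - y| := abs_pos.2 (sub_ne_zero.2 (Ne.symm hyx))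
    have hle : |x - y| ≤ x + y := abs_le.2 ⟨by linarith, by linarith⟩
    exact mul_nonpos_of_nonpos_of_nonneg (hK'nonpos y hy)
      (sub_nonneg.2 (hJmono hpos (show 0 < x + y by linarith) hle))
  refine ⟨fun x => ?_, fun x _ => hformula x, hnonpos, ?_⟩
  · rw [hH, hH, ← integral_neg_eq_self]
    refine integral_congr_ae (Eventually.of_forall fun y => ?_)
    dsimp only
    rw [hJeven, ← hKeven (x - y)]
    congr 2
    ring
  · have hd : Differentiable ℝ H := fun x => (hderiv x).differentiableAt
    refine antitoneOn_of_deriv_nonpos (convex_Ioi 0) hd.continuous.continuousOn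
      hd.differentiableOn fun x hx => hnonpos x ?_
    rwa [interior_Ioi] at hx
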